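/- arXiv:2106.05949 — 5 statements merged into one kernel-verified Lean document; each statement's English description precedes it below -/
import Mathlib

section
/- For n ≥ 2, the Möbius function of the finite lattice L_n evaluated on the whole lattice equals the classical number-theoretic Möbius function at n-1: μ_{L_n}(∅, [n]) = μ(n-1). Moreover μ_{L_1}(∅, [1]) = -1. -/
open scoped Classical

/-- An arithmetic progression of integers: a finite set of the form
`{a, a+r, ..., a+(k-1)r}` with `a : ℤ`, `r ≥ 1` and `k ≥ 0` (so the empty set and all
singletons are arithmetic progressions). -/
def IsAP (s : Finset ℤ) : Prop :=
  ∃ (a r : ℤ) (k : ℕ), 1 ≤ r ∧ s = (Finset.range k).image (fun i => a + (i : ℤ) * r)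

/-- The number `p_{nk}` of arithmetic progressions of cardinality `k` contained in `{1,…,n}`. -/
noncomputable def numAP (n k : ℕ) : ℕ :=
  ((Finset.Icc (1:ℤ) (n:ℤ)).powerset.filter (fun s => IsAP s ∧ s.card = k)).card

/-- The Möbius function of the poset of arithmetic progressions ordered by inclusion,
defined by `μ(x,x) = 1` and `μ(x,y) = -∑_{x ≤ z < y} μ(x,z)`, where `z` ranges over
arithmetic progressions with `x ⊆ z ⊂ y`.  (For `x ⊆ y ⊆ {1,…,n}`, all arithmetic
progressions `z` with `x ⊆ z ⊂ y` automatically lie in `L_n`, so this is the Möbius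
function of any interval `[x, y]` of the lattice `L_n`.) -/
noncomputable def apMu (x y : Finset ℤ) : ℤ :=
  if x = y then 1
  else - ∑ z ∈ (y.powerset.filter (fun z => IsAP z ∧ x ⊆ z ∧ z ≠ y)).attach, apMu x z.1
termination_by y.card
decreasing_by
  rename_i z
  have hz := z.2
  rw [Finset.mem_filter, Finset.mem_powerset] at hz
  exact Finset.card_lt_card (lt_of_le_of_ne hz.1 hz.2.2.2)

/-- The join of `a` and `b` in the lattice of arithmetic progressions contained in `t`:
the intersection of all arithmetic progressions contained in `t` that contain `a ∪ b`,
i.e. the smallest such progression. -/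
noncomputable def apJoin (t a b : Finset ℤ) : Finset ℤ :=
  t.filter (fun v => ∀ z : Finset ℤ, IsAP z → z ⊆ t → a ∪ b ⊆ z → v ∈ z)

/-- The meet (intersection) of a finite family `S` of subsets of the top element `t`;
the meet of the empty family is `t` itself. -/
def apMeet (t : Finset ℤ) (S : Finset (Finset ℤ)) : Finset ℤ :=
  S.fold (· ⊓ ·) t id

/-- `x` is a coatom of the lattice `L_n` of arithmetic progressions contained in
`{1,…,n}`: an element distinct from the maximum `{1,…,n}` with no element strictly
between it and the maximum. -/
def IsCoatomIn (n : ℕ) (x : Finset ℤ) : Prop :=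
  IsAP x ∧ x ⊆ Finset.Icc (1:ℤ) (n:ℤ) ∧ x ≠ Finset.Icc (1:ℤ) (n:ℤ) ∧
    ∀ y : Finset ℤ, IsAP y → y ⊆ Finset.Icc (1:ℤ) (n:ℤ) → x ⊂ y → y = Finset.Icc (1:ℤ) (n:ℤ)

/-- `y` is covered by `top` in the poset of arithmetic progressions: `y < top` and there
is no arithmetic progression strictly between them. -/
def CoveredIn (top y : Finset ℤ) : Prop :=
  IsAP y ∧ y ⊂ top ∧ ¬ ∃ z : Finset ℤ, IsAP z ∧ y ⊂ z ∧ z ⊂ top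

/-- `c` is a maximal chain in the lattice `L_n` of arithmetic progressions contained
in `{1,…,n}`: a chain (under inclusion) of elements of `L_n` to which no further
element of `L_n` can be added. -/
def IsMaxChainIn (n : ℕ) (c : Finset (Finset ℤ)) : Prop :=
  (∀ s ∈ c, IsAP s ∧ s ⊆ Finset.Icc (1:ℤ) (n:ℤ)) ∧
  IsChain (· ⊆ ·) (↑c : Set (Finset ℤ)) ∧
  ∀ z : Finset ℤ, IsAP z → z ⊆ Finset.Icc (1:ℤ) (n:ℤ) →
    IsChain (· ⊆ ·) (insert z (↑c : Set (Finset ℤ))) → z ∈ c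

/-- The number `b_{nk}` of chains of length `k` (i.e. totally ordered subsets with `k+1`
elements) in `L_n` that contain both `∅` and `{1,…,n}`. -/
noncomputable def numChains (n k : ℕ) : ℕ :=
  (((Finset.Icc (1:ℤ) (n:ℤ)).powerset.filter IsAP).powerset.filter
    (fun c : Finset (Finset ℤ) => c.card = k + 1 ∧ ∅ ∈ c ∧ Finset.Icc (1:ℤ) (n:ℤ) ∈ c ∧
      IsChain (· ⊆ ·) (↑c : Set (Finset ℤ)))).card

namespace ArithmeticProgression

open Finset

/-- The number-theoretic value of the Möbius function `μ(∅, z)` at a progression `z` with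
`k` elements. -/
def weight : ℕ → ℤ
  | 0 => 1
  | 1 => -1
  | k + 2 => ArithmeticFunction.moebius (k + 1)

/-- The progression with `k` elements, first term `a` and common difference `r`. -/
def prog (a r : ℤ) (k : ℕ) : Finset ℤ :=
  (range k).image (fun i : ℕ => a + (i : ℤ) * r)

theorem isAP_iff {z : Finset ℤ} :
    IsAP z ↔ ∃ (a r : ℤ) (k : ℕ), 1 ≤ r ∧ z = prog a r k := by
  unfold IsAP
  refine exists_congr fun a => exists_congr fun r => exists_congr fun k =>
    and_congr_right fun _ => ?_
  rw [prog, show (range k >>= fun i : ℕ => (pure (i : ℤ) : Finset ℤ)) =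
    (range k).image (fun i : ℕ => (i : ℤ)) from ?_, image_image]
  · rfl
  · ext x
    simp [Finset.bind_def, eq_comm]

theorem mem_prog {a r x : ℤ} {k : ℕ} : x ∈ prog a r k ↔ ∃ i < k, a + (i : ℤ) * r = x := by
  simp [prog]

theorem card_prog (a : ℤ) {r : ℤ} (hr : 1 ≤ r) (k : ℕ) : (prog a r k).card = k := by
  rw [prog, card_image_of_injective, card_range]
  intro i j h
  have h' : ((i : ℤ)) * r = j * r := by simpa using h
  exact_mod_cast mul_right_cancel₀ (by omega) h'

theorem first_le {a r x : ℤ} (hr : 1 ≤ r) {k : ℕ} (hx : x ∈ prog a r k) : a ≤ x := by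
  obtain ⟨i, -, rfl⟩ := mem_prog.1 hx
  nlinarith [Int.natCast_nonneg i]

theorem le_last {a r x : ℤ} (hr : 1 ≤ r) {m : ℕ} (hx : x ∈ prog a r (m + 1)) :
    x ≤ a + (m : ℤ) * r := by
  obtain ⟨i, hi, rfl⟩ := mem_prog.1 hx
  have : (i : ℤ) ≤ m := by omega
  nlinarith

theorem first_mem (a r : ℤ) (m : ℕ) : a ∈ prog a r (m + 1) :=
  mem_prog.2 ⟨0, by omega, by simp⟩

theorem last_mem (a r : ℤ) (m : ℕ) : a + (m : ℤ) * r ∈ prog a r (m + 1) :=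
  mem_prog.2 ⟨m, by omega, rfl⟩

theorem prog_injective {a r b s : ℤ} {m l : ℕ} (hr : 1 ≤ r) (hs : 1 ≤ s) (hm : 1 ≤ m)
    (h : prog a r (m + 1) = prog b s (l + 1)) : a = b ∧ r = s ∧ m = l := by
  have hml : m = l := by
    have := congrArg card h
    rw [card_prog a hr, card_prog b hs] at this
    omega
  subst hml
  have hab : a = b := le_antisymm
    (first_le hr (h ▸ first_mem b s m)) (first_le hs (h ▸ first_mem a r m))
  subst hab
  have hlast : a + (m : ℤ) * r = a + (m : ℤ) * s := le_antisymm
    (le_last hs (h ▸ last_mem a r m)) (le_last hr (h ▸ last_mem a s m))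
  refine ⟨rfl, mul_left_cancel₀ (a := (m : ℤ)) (by omega) (by linarith), rfl⟩

theorem prog_subset {a r : ℤ} {k i d m : ℕ} (h : i + d * m < k) :
    prog (a + (i : ℤ) * r) ((d : ℤ) * r) (m + 1) ⊆ prog a r k := by
  intro x hx
  obtain ⟨t, ht, rfl⟩ := mem_prog.1 hx
  refine mem_prog.2 ⟨i + d * t, ?_, by push_cast; ring⟩
  have : d * t ≤ d * m := Nat.mul_le_mul_left _ (by omega)
  omega

theorem exists_of_subset {a r b s : ℤ} {k m : ℕ} (hr : 1 ≤ r) (hs : 1 ≤ s) (hm : 1 ≤ m)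
    (h : prog b s (m + 1) ⊆ prog a r k) :
    ∃ i d : ℕ, 1 ≤ d ∧ i + d * m < k ∧ b = a + (i : ℤ) * r ∧ s = (d : ℤ) * r := by
  obtain ⟨i, hi, hib⟩ := mem_prog.1 (h (first_mem b s m))
  obtain ⟨j, hj, hjb⟩ := mem_prog.1 (h (mem_prog.2 ⟨1, by omega, rfl⟩ : b + ((1 : ℕ) : ℤ) * s ∈ _))
  obtain ⟨l, hl, hlb⟩ := mem_prog.1 (h (last_mem b s m))
  push_cast at hjb
  have hs' : s = ((j : ℤ) - i) * r := by linarith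
  have hij : i < j := by
    by_contra hcon
    have : (j : ℤ) - i ≤ 0 := by omega
    nlinarith
  obtain ⟨d, rfl⟩ := Nat.exists_eq_add_of_lt hij
  have hsd : s = ((d + 1 : ℕ) : ℤ) * r := by rw [hs']; push_cast; ring
  refine ⟨i, d + 1, by omega, ?_, hib.symm, hsd⟩
  have hl' : (l : ℤ) * r = ((i + (d + 1) * m : ℕ) : ℤ) * r := by
    rw [hsd, ← hib] at hlb
    push_cast at hlb ⊢
    linarith
  have : l = i + (d + 1) * m := by
    exact_mod_cast mul_right_cancel₀ (by omega) hl'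
  omega

theorem sum_moebius_divisorsAntidiagonal (N : ℕ) :
    ∑ p ∈ N.divisorsAntidiagonal, ArithmeticFunction.moebius p.2 = if N = 1 then 1 else 0 := by
  have h := congrArg (fun f : ArithmeticFunction ℤ => f N)
    ArithmeticFunction.coe_zeta_mul_moebius
  simp only [ArithmeticFunction.coe_zeta_mul_apply, ArithmeticFunction.one_apply] at h
  rw [Nat.sum_divisorsAntidiagonal' (f := fun _ m => ArithmeticFunction.moebius m)]
  exact h

theorem sum_sigma_moebius (k : ℕ) :
    ∑ i ∈ range (k + 1), ∑ N ∈ Ico 1 (k + 1 - i), ∑ p ∈ N.divisorsAntidiagonal,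
      ArithmeticFunction.moebius p.2 = k := by
  simp only [sum_moebius_divisorsAntidiagonal, sum_ite_eq', mem_Ico, le_refl, true_and]
  rw [sum_range_succ, sum_congr rfl (g := fun _ => (1 : ℤ))]
  · simp
  · intro i hi
    rw [mem_range] at hi
    rw [if_pos (by omega)]

/-- Progressions with at least two terms inside a given one, weighted by `μ` of the number
of steps: summing over the divisors of the distance between the end points shows that only
the pairs of consecutive terms contribute. -/
theorem sum_weight_long {a r : ℤ} (hr : 1 ≤ r) (k : ℕ) :
    ∑ z ∈ (prog a r (k + 1)).powerset.filter (fun z => IsAP z ∧ 2 ≤ z.card), weight z.card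
      = k := by
  rw [← sum_sigma_moebius k]
  simp_rw [sum_sigma']
  symm
  refine sum_bij
    (fun x _ => prog (a + (x.1 : ℤ) * r) ((x.2.2.1 : ℤ) * r) (x.2.2.2 + 1)) ?_ ?_ ?_ ?_
  · rintro ⟨i, N, d, m⟩ hx
    simp only [mem_sigma, mem_range, mem_Ico, Nat.mem_divisorsAntidiagonal] at hx
    obtain ⟨hi, ⟨h1, h2⟩, rfl, h0⟩ := hx
    have hd : 1 ≤ d := Nat.pos_of_ne_zero (left_ne_zero_of_mul h0)
    have hm : 1 ≤ m := Nat.pos_of_ne_zero (right_ne_zero_of_mul h0)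
    have hdr : 1 ≤ (d : ℤ) * r := by
      have : (1 : ℤ) ≤ d := by omega
      nlinarith
    dsimp only
    rw [mem_filter, mem_powerset, card_prog _ hdr]
    exact ⟨prog_subset (by omega), isAP_iff.2 ⟨_, _, _, hdr, rfl⟩, by omega⟩
  · rintro ⟨i, N, d, m⟩ hx ⟨i', N', d', m'⟩ hx' h
    simp only [mem_sigma, mem_range, mem_Ico, Nat.mem_divisorsAntidiagonal] at hx hx'
    obtain ⟨hi, ⟨h1, h2⟩, rfl, h0⟩ := hx
    obtain ⟨hi', ⟨h1', h2'⟩, rfl, h0'⟩ := hx'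
    have hd : (1 : ℤ) ≤ d := by
      exact_mod_cast Nat.pos_of_ne_zero (left_ne_zero_of_mul h0)
    have hd' : (1 : ℤ) ≤ d' := by
      exact_mod_cast Nat.pos_of_ne_zero (left_ne_zero_of_mul h0')
    have hm : 1 ≤ m := Nat.pos_of_ne_zero (right_ne_zero_of_mul h0)
    obtain ⟨e1, e2, e3⟩ := prog_injective (by nlinarith) (by nlinarith) hm h
    have e1' : (i : ℤ) = i' := mul_right_cancel₀ (b := r) (by omega) (by simpa using e1)
    have e2' : (d : ℤ) = d' := mul_right_cancel₀ (b := r) (by omega) e2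
    obtain rfl : i = i' := by exact_mod_cast e1'
    obtain rfl : d = d' := by exact_mod_cast e2'
    obtain rfl : m = m' := e3
    rfl
  · intro z hz
    rw [mem_filter, mem_powerset, isAP_iff] at hz
    obtain ⟨hsub, ⟨b, s, l, hs, rfl⟩, hc⟩ := hz
    rw [card_prog b hs] at hc
    obtain ⟨m, rfl⟩ : ∃ m, l = m + 1 := ⟨l - 1, by omega⟩
    obtain ⟨i, d, hd, hlt, rfl, rfl⟩ := exists_of_subset hr hs (by omega) hsub
    have hpos : 1 ≤ d * m := Nat.mul_pos hd (by omega)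
    refine ⟨⟨i, d * m, d, m⟩, ?_, rfl⟩
    simp only [mem_sigma, mem_range, mem_Ico, Nat.mem_divisorsAntidiagonal]
    exact ⟨by omega, ⟨hpos, by omega⟩, trivial, by omega⟩
  · rintro ⟨i, N, d, m⟩ hx
    simp only [mem_sigma, mem_range, mem_Ico, Nat.mem_divisorsAntidiagonal] at hx
    obtain ⟨hi, ⟨h1, h2⟩, rfl, h0⟩ := hx
    have hd : (1 : ℤ) ≤ d := by
      exact_mod_cast Nat.pos_of_ne_zero (left_ne_zero_of_mul h0)
    obtain ⟨m, rfl⟩ := Nat.exists_eq_succ_of_ne_zero (right_ne_zero_of_mul h0)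
    rw [card_prog _ (by nlinarith)]
    rfl

theorem isAP_of_card_le_one {z : Finset ℤ} (h : z.card ≤ 1) : IsAP z := by
  rcases Finset.card_le_one_iff_subset_singleton.1 h with ⟨x, hx⟩
  rcases Finset.subset_singleton_iff.1 hx with rfl | rfl
  · exact isAP_iff.2 ⟨0, 1, 0, le_rfl, by simp [prog]⟩
  · exact isAP_iff.2 ⟨x, 1, 1, le_rfl, by simp [prog]⟩

theorem sum_weight_short (y : Finset ℤ) :
    ∑ z ∈ y.powerset.filter (fun z => IsAP z ∧ ¬ 2 ≤ z.card), weight z.card = 1 - y.card := by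
  have h : y.powerset.filter (fun z => IsAP z ∧ ¬ 2 ≤ z.card)
      = (y.powersetCard 0) ∪ (y.powersetCard 1) := by
    ext z
    simp only [mem_filter, mem_powerset, mem_union, mem_powersetCard]
    constructor
    · rintro ⟨h1, -, h2⟩
      have : z.card = 0 ∨ z.card = 1 := by omega
      tauto
    · rintro (⟨h1, h2⟩ | ⟨h1, h2⟩) <;>
        exact ⟨h1, isAP_of_card_le_one (by omega), by omega⟩
  rw [h, sum_union (pairwise_disjoint_powersetCard y (by decide : (0 : ℕ) ≠ 1)),
    sum_congr rfl (g := fun _ => (1 : ℤ)), sum_congr (s₁ := y.powersetCard 1) rfl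
      (g := fun _ => (-1 : ℤ))]
  · simp [sub_eq_add_neg]
  · intro z hz
    rw [(mem_powersetCard.1 hz).2]
    rfl
  · intro z hz
    rw [(mem_powersetCard.1 hz).2]
    rfl

theorem sum_weight_eq_zero {y : Finset ℤ} (hy : IsAP y) (hne : y ≠ ∅) :
    ∑ z ∈ y.powerset.filter IsAP, weight z.card = 0 := by
  obtain ⟨a, r, k, hr, rfl⟩ := isAP_iff.1 hy
  obtain ⟨k, rfl⟩ : ∃ l, k = l + 1 := Nat.exists_eq_succ_of_ne_zero (by rintro rfl; simp [prog] at hne)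
  rw [← sum_filter_add_sum_filter_not _ (fun z : Finset ℤ => 2 ≤ z.card), filter_filter,
    filter_filter, sum_weight_long hr, sum_weight_short, card_prog a hr]
  push_cast
  ring

theorem apMu_empty_eq_weight (y : Finset ℤ) (hy : IsAP y) : apMu ∅ y = weight y.card := by
  induction hn : y.card using Nat.strong_induction_on generalizing y with
  | _ n ih =>
    subst hn
    rw [apMu]
    split_ifs with h
    · subst h
      rfl
    · have hsplit : y.powerset.filter IsAP
          = insert y (y.powerset.filter (fun z => IsAP z ∧ ∅ ⊆ z ∧ z ≠ y)) := by
        ext z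
        simp only [mem_filter, mem_powerset, mem_insert, empty_subset, true_and]
        constructor
        · tauto
        · rintro (rfl | h')
          · exact ⟨subset_rfl, hy⟩
          · tauto
      have hsum := sum_weight_eq_zero hy (Ne.symm h)
      rw [hsplit, sum_insert (by simp)] at hsum
      rw [sum_attach _ (fun z => apMu ∅ z), sum_congr rfl (g := fun z => weight z.card)]
      · linarith
      · intro z hz
        rw [mem_filter, mem_powerset] at hz
        exact ih _ (card_lt_card (lt_of_le_of_ne hz.1 hz.2.2.2)) z hz.2.1 rfl

theorem isAP_Icc (n : ℕ) : IsAP (Icc (1 : ℤ) n) := by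
  refine isAP_iff.2 ⟨1, 1, n, le_rfl, ?_⟩
  ext x
  simp only [mem_Icc, mem_prog, mul_one]
  exact ⟨fun h => ⟨(x - 1).toNat, by omega, by omega⟩, by rintro ⟨i, hi, rfl⟩; omega⟩

theorem apMu_empty_Icc (n : ℕ) : apMu ∅ (Icc (1 : ℤ) n) = weight n := by
  rw [apMu_empty_eq_weight _ (isAP_Icc n)]
  simp

end ArithmeticProgression

/-- For `n ≥ 2`, the Möbius function of `L_n` evaluated on the whole lattice equals the
classical Möbius function at `n-1`; moreover `μ_{L_1}(∅, [1]) = -1`. -/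
theorem mobius_Ln_eq_moebius :
    (∀ n : ℕ, 2 ≤ n →
      apMu ∅ (Finset.Icc (1:ℤ) (n:ℤ)) = ArithmeticFunction.moebius (n - 1)) ∧
    apMu ∅ (Finset.Icc (1:ℤ) ((1:ℕ):ℤ)) = -1 := by
  refine ⟨fun n hn => ?_, ArithmeticProgression.apMu_empty_Icc 1⟩
  obtain ⟨k, rfl⟩ := Nat.exists_eq_add_of_le' hn
  exact ArithmeticProgression.apMu_empty_Icc (k + 2)
end

section
/- For every n ≥ 4, the lattice L_n is not graded: there exist two maximal chains in L_n having different lengths. Specifically, ∅ ⊂ {1} ⊂ {1,4} ⊂ {1,2,3,4} ⊂ {1,...,5} ⊂ ⋯ ⊂ [n] is a maximal chain of length n, while ∅ ⊂ {1} ⊂ {1,2} ⊂ {1,2,3} ⊂ ⋯ ⊂ [n] is a maximal chain of length n+1 (counting the edge from ∅). -/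
open scoped Classical

theorem isAP_iff {s : Finset ℤ} :
    IsAP s ↔ ∃ (a r : ℤ) (k : ℕ), 1 ≤ r ∧ ∀ x, x ∈ s ↔ ∃ i : ℕ, i < k ∧ a + (i : ℤ) * r = x := by
  simp [IsAP, Finset.ext_iff]

theorem isAP_Icc_one (k : ℕ) : IsAP (Finset.Icc (1:ℤ) (k:ℤ)) := by
  refine isAP_iff.2 ⟨1, 1, k, le_rfl, fun x => ?_⟩
  rw [Finset.mem_Icc]
  constructor
  · rintro ⟨h1, h2⟩
    exact ⟨(x - 1).toNat, by omega, by omega⟩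
  · rintro ⟨i, hi, rfl⟩
    omega

theorem isAP_empty : IsAP ∅ := isAP_iff.2 ⟨0, 1, 0, le_rfl, by simp⟩

theorem isAP_singleton (a : ℤ) : IsAP {a} :=
  isAP_iff.2 ⟨a, 1, 1, le_rfl, by simp [eq_comm]⟩

theorem isAP_one_four : IsAP {1, 4} := by
  refine isAP_iff.2 ⟨1, 3, 2, by norm_num, fun x => ?_⟩
  simp only [Finset.mem_insert, Finset.mem_singleton]
  constructor
  · rintro (rfl | rfl)
    · exact ⟨0, by norm_num, by norm_num⟩
    · exact ⟨1, by norm_num, by norm_num⟩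
  · rintro ⟨i, hi, rfl⟩
    omega

/-- An arithmetic progression containing two consecutive integers is an interval. -/
theorem IsAP.mem_of_consecutive {s : Finset ℤ} (hs : IsAP s) {b u v w : ℤ}
    (hb : b ∈ s) (hb' : b + 1 ∈ s) (hu : u ∈ s) (hv : v ∈ s) (huw : u ≤ w) (hwv : w ≤ v) :
    w ∈ s := by
  obtain ⟨a, r, k, hr, hs⟩ := isAP_iff.1 hs
  rw [hs] at hb hb' hu hv ⊢
  obtain ⟨i, -, hi⟩ := hb
  obtain ⟨j, -, hj⟩ := hb'
  have hr1 : r = 1 := by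
    have hdvd : r ∣ 1 := ⟨(j : ℤ) - i, by linarith⟩
    exact le_antisymm (Int.le_of_dvd one_pos hdvd) hr
  subst hr1
  obtain ⟨p, hp, rfl⟩ := hu
  obtain ⟨q, hq, rfl⟩ := hv
  exact ⟨(w - a).toNat, by omega, by omega⟩

theorem Icc_one_injective :
    Function.Injective (fun k : ℕ => Finset.Icc (1:ℤ) (k:ℤ)) := fun a b h => by
  simpa using congrArg Finset.card h

theorem Icc_one_subset_total (a b : ℕ) :
    Finset.Icc (1:ℤ) a ⊆ Finset.Icc (1:ℤ) b ∨ Finset.Icc (1:ℤ) b ⊆ Finset.Icc (1:ℤ) a :=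
  (le_total a b).imp (fun h => Finset.Icc_subset_Icc_right (by exact_mod_cast h))
    (fun h => Finset.Icc_subset_Icc_right (by exact_mod_cast h))

/-- A set with maximum `m + 1` that is comparable with `{1,…,m}` is `{1,…,m+1}`. -/
theorem eq_Icc_one_of_comparable {z : Finset ℤ} {m : ℕ} (hpos : ∀ x ∈ z, 1 ≤ x)
    (hm : (m : ℤ) + 1 ∈ z) (hmax : ∀ x ∈ z, x ≤ (m : ℤ) + 1)
    (hcomp : z ⊆ Finset.Icc (1:ℤ) m ∨ Finset.Icc (1:ℤ) m ⊆ z) :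
    z = Finset.Icc (1:ℤ) ((m + 1 : ℕ) : ℤ) := by
  rcases hcomp with h | h
  · have := Finset.mem_Icc.1 (h hm)
    omega
  · ext x
    rw [Finset.mem_Icc]
    refine ⟨fun hx => ⟨hpos x hx, by simpa using hmax x hx⟩, fun ⟨h1, h2⟩ => ?_⟩
    by_cases hx : x = m + 1
    · exact hx ▸ hm
    · exact h (Finset.mem_Icc.2 ⟨h1, by push_cast at h2; omega⟩)

theorem exists_nat_max {n : ℕ} {z : Finset ℤ} (hz : z ⊆ Finset.Icc (1:ℤ) n) (hne : z.Nonempty) :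
    ∃ m : ℕ, m + 1 ≤ n ∧ (m : ℤ) + 1 ∈ z ∧ ∀ x ∈ z, x ≤ (m : ℤ) + 1 := by
  have hmem := z.max'_mem hne
  have hb := Finset.mem_Icc.1 (hz hmem)
  have hcast : (((z.max' hne - 1).toNat : ℕ) : ℤ) + 1 = z.max' hne := by omega
  exact ⟨(z.max' hne - 1).toNat, by omega, by rwa [hcast],
    fun x hx => by rw [hcast]; exact z.le_max' x hx⟩

theorem isMaxChainIn_Icc_one (n : ℕ) :
    IsMaxChainIn n ((Finset.range (n+1)).image (fun k : ℕ => Finset.Icc (1:ℤ) (k:ℤ))) := by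
  refine ⟨?_, ?_, ?_⟩
  · intro s hs
    obtain ⟨k, hk, rfl⟩ := Finset.mem_image.1 hs
    rw [Finset.mem_range] at hk
    exact ⟨isAP_Icc_one k, Finset.Icc_subset_Icc_right (by omega)⟩
  · intro s hs t ht _
    obtain ⟨a, -, rfl⟩ := Finset.mem_image.1 (Finset.mem_coe.1 hs)
    obtain ⟨b, -, rfl⟩ := Finset.mem_image.1 (Finset.mem_coe.1 ht)
    exact Icc_one_subset_total a b
  · intro z _ hzn hz
    rw [Finset.mem_image]
    rcases z.eq_empty_or_nonempty with rfl | hne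
    · exact ⟨0, by simp, by simp⟩
    obtain ⟨m, hmn, hm, hmax⟩ := exists_nat_max hzn hne
    refine ⟨m + 1, by simp; omega, (eq_Icc_one_of_comparable
      (fun x hx => (Finset.mem_Icc.1 (hzn hx)).1) hm hmax ?_).symm⟩
    refine hz.total (Set.mem_insert _ _) (Set.mem_insert_of_mem _ ?_)
    exact Finset.mem_coe.2 (Finset.mem_image.2 ⟨m, by simp; omega, rfl⟩)

theorem one_four_subset_Icc {k : ℕ} (hk : 4 ≤ k) : ({1, 4} : Finset ℤ) ⊆ Finset.Icc (1:ℤ) k := by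
  intro x hx
  simp only [Finset.mem_insert, Finset.mem_singleton] at hx
  rw [Finset.mem_Icc]
  omega

theorem one_subset_Icc {k : ℕ} (hk : 1 ≤ k) : ({1} : Finset ℤ) ⊆ Finset.Icc (1:ℤ) k := by
  simpa using hk

/-- The arithmetic progressions in `{1,2,3,4}` containing `1` and `4`. -/
theorem IsAP.eq_of_one_four_subset {z : Finset ℤ} (hz : IsAP z) (h1 : (1:ℤ) ∈ z)
    (h4 : (4:ℤ) ∈ z) (hsub : z ⊆ Finset.Icc (1:ℤ) 4) : z = {1, 4} ∨ z = Finset.Icc (1:ℤ) 4 := by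
  by_cases h : (2:ℤ) ∈ z ∨ (3:ℤ) ∈ z
  · right
    refine hsub.antisymm fun w hw => ?_
    rw [Finset.mem_Icc] at hw
    rcases h with h | h
    · exact hz.mem_of_consecutive h1 h h1 h4 hw.1 hw.2
    · exact hz.mem_of_consecutive h h4 h1 h4 hw.1 hw.2
  · left
    push Not at h
    ext x
    simp only [Finset.mem_insert, Finset.mem_singleton]
    constructor
    · intro hx
      have hb := Finset.mem_Icc.1 (hsub hx)
      have h2 : x ≠ 2 := fun e => h.1 (e ▸ hx)
      have h3 : x ≠ 3 := fun e => h.2 (e ▸ hx)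
      omega
    · rintro (rfl | rfl) <;> assumption

theorem mem_chain_through_one_four {n : ℕ} {s : Finset ℤ} :
    s ∈ insert (∅ : Finset ℤ) (insert {1} (insert ({1, 4} : Finset ℤ)
      ((Finset.Icc 4 n).image (fun k : ℕ => Finset.Icc (1:ℤ) (k:ℤ))))) ↔
    s = ∅ ∨ s = {1} ∨ s = {1, 4} ∨ ∃ k : ℕ, (4 ≤ k ∧ k ≤ n) ∧ Finset.Icc (1:ℤ) k = s := by
  simp only [Finset.mem_insert, Finset.mem_image, Finset.mem_Icc]

theorem isMaxChainIn_through_one_four {n : ℕ} (hn : 4 ≤ n) :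
    IsMaxChainIn n (insert (∅ : Finset ℤ) (insert {1} (insert ({1, 4} : Finset ℤ)
      ((Finset.Icc 4 n).image (fun k : ℕ => Finset.Icc (1:ℤ) (k:ℤ)))))) := by
  refine ⟨?_, ?_, ?_⟩
  · intro s hs
    rcases mem_chain_through_one_four.1 hs with rfl | rfl | rfl | ⟨k, hk, rfl⟩
    · exact ⟨isAP_empty, Finset.empty_subset _⟩
    · exact ⟨isAP_singleton 1, one_subset_Icc (by omega)⟩
    · exact ⟨isAP_one_four, one_four_subset_Icc hn⟩
    · exact ⟨isAP_Icc_one k, Finset.Icc_subset_Icc_right (by omega)⟩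
  · have h14 : ({1} : Finset ℤ) ⊆ {1, 4} := by simp
    intro s hs t ht _
    rcases mem_chain_through_one_four.1 (Finset.mem_coe.1 hs) with
      rfl | rfl | rfl | ⟨a, ha, rfl⟩
    · exact .inl (Finset.empty_subset _)
    all_goals
      rcases mem_chain_through_one_four.1 (Finset.mem_coe.1 ht) with
        rfl | rfl | rfl | ⟨b, hb, rfl⟩
    any_goals exact .inr (Finset.empty_subset _)
    · exact .inl subset_rfl
    · exact .inl h14
    · exact .inl (one_subset_Icc (by omega))
    · exact .inr h14
    · exact .inl subset_rfl
    · exact .inl (one_four_subset_Icc hb.1)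
    · exact .inr (one_subset_Icc (by omega))
    · exact .inr (one_four_subset_Icc ha.1)
    · exact Icc_one_subset_total a b
  · intro z hAP hzn hz
    have hcomp {s : Finset ℤ} (hs : s = ∅ ∨ s = {1} ∨ s = {1, 4} ∨
        ∃ k : ℕ, (4 ≤ k ∧ k ≤ n) ∧ Finset.Icc (1:ℤ) k = s) : z ⊆ s ∨ s ⊆ z :=
      hz.total (Set.mem_insert _ _)
        (Set.mem_insert_of_mem _ (Finset.mem_coe.2 (mem_chain_through_one_four.2 hs)))
    rw [mem_chain_through_one_four]
    rcases z.eq_empty_or_nonempty with rfl | hne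
    · exact .inl rfl
    obtain ⟨m, hmn, hm, hmax⟩ := exists_nat_max hzn hne
    have hpos : ∀ x ∈ z, 1 ≤ x := fun x hx => (Finset.mem_Icc.1 (hzn hx)).1
    by_cases hm4 : 4 ≤ m
    · refine .inr (.inr (.inr ⟨m + 1, by omega, (eq_Icc_one_of_comparable hpos hm hmax
        (hcomp (.inr (.inr (.inr ⟨m, by omega, rfl⟩))))).symm⟩))
    rcases hcomp (.inr (.inl rfl)) with h | h
    · exact .inr (.inl ((Finset.subset_singleton_iff.1 h).resolve_left hne.ne_empty))
    have h1 : (1:ℤ) ∈ z := Finset.singleton_subset_iff.1 h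
    rcases hcomp (.inr (.inr (.inl rfl))) with h' | h'
    · by_cases h4 : (4:ℤ) ∈ z
      · refine .inr (.inr (.inl (h'.antisymm ?_)))
        simp [Finset.insert_subset_iff, h1, h4]
      · refine .inr (.inl (Finset.Subset.antisymm (fun x hx => ?_) h))
        have hx' := h' hx
        simp only [Finset.mem_insert, Finset.mem_singleton] at hx' ⊢
        exact hx'.resolve_right fun e => h4 (e ▸ hx)
    · have h4 : (4:ℤ) ∈ z := h' (by simp)
      have hsub : z ⊆ Finset.Icc (1:ℤ) 4 := fun x hx =>
        Finset.mem_Icc.2 ⟨hpos x hx, by have := hmax x hx; omega⟩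
      rcases hAP.eq_of_one_four_subset h1 h4 hsub with h | h
      · exact .inr (.inr (.inl h))
      · exact .inr (.inr (.inr ⟨4, by omega, by simpa using h.symm⟩))

theorem card_chain_through_one_four {n : ℕ} (hn : 4 ≤ n) :
    (insert (∅ : Finset ℤ) (insert {1} (insert ({1, 4} : Finset ℤ)
      ((Finset.Icc 4 n).image (fun k : ℕ => Finset.Icc (1:ℤ) (k:ℤ)))))).card = n := by
  have hcard {s : Finset ℤ}
      (hs : s ∈ (Finset.Icc 4 n).image (fun k : ℕ => Finset.Icc (1:ℤ) (k:ℤ))) : 4 ≤ s.card := by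
    obtain ⟨k, hk, rfl⟩ := Finset.mem_image.1 hs
    simpa using (Finset.mem_Icc.1 hk).1
  have hpair : ({1, 4} : Finset ℤ).card = 2 := Finset.card_pair (by norm_num)
  have hne : ({1} : Finset ℤ) ≠ {1, 4} := fun h => by
    have := congrArg Finset.card h
    rw [hpair, Finset.card_singleton] at this
    omega
  rw [Finset.card_insert_of_notMem, Finset.card_insert_of_notMem, Finset.card_insert_of_notMem,
    Finset.card_image_of_injective _ Icc_one_injective, Nat.card_Icc]
  · omega
  · intro h
    have := hcard h
    omega
  · rw [Finset.mem_insert]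
    rintro (h | h)
    · exact hne h
    · have := hcard h
      rw [Finset.card_singleton] at this
      omega
  · rw [Finset.mem_insert, Finset.mem_insert]
    rintro (h | h | h)
    · exact Finset.singleton_ne_empty _ h.symm
    · exact Finset.insert_ne_empty _ _ h.symm
    · have := hcard h
      rw [Finset.card_empty] at this
      omega

theorem card_image_range_Icc_one (n : ℕ) :
    ((Finset.range (n+1)).image (fun k : ℕ => Finset.Icc (1:ℤ) (k:ℤ))).card = n + 1 := by
  rw [Finset.card_image_of_injective _ Icc_one_injective, Finset.card_range]

/-- For `n ≥ 4`, the lattice `L_n` is not graded: the chain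
`∅ ⊂ {1} ⊂ {1,4} ⊂ {1,2,3,4} ⊂ {1,…,5} ⊂ ⋯ ⊂ [n]` is a maximal chain with `n` elements
(length `n`), while `∅ ⊂ {1} ⊂ {1,2} ⊂ ⋯ ⊂ [n]` is a maximal chain with `n+1` elements
(length `n+1`, counting the edge from `∅`); in particular two maximal chains of `L_n`
have different lengths. -/
theorem Ln_not_graded (n : ℕ) (hn : 4 ≤ n) :
    ∃ c₁ c₂ : Finset (Finset ℤ),
      c₁ = insert (∅ : Finset ℤ) (insert {1} (insert ({1, 4} : Finset ℤ)
            ((Finset.Icc 4 n).image (fun k : ℕ => Finset.Icc (1:ℤ) (k:ℤ))))) ∧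
      c₂ = (Finset.range (n+1)).image (fun k : ℕ => Finset.Icc (1:ℤ) (k:ℤ)) ∧
      IsMaxChainIn n c₁ ∧ IsMaxChainIn n c₂ ∧
      c₁.card = n ∧ c₂.card = n + 1 ∧ c₁.card ≠ c₂.card := by
  refine ⟨_, _, rfl, rfl, isMaxChainIn_through_one_four hn, isMaxChainIn_Icc_one n,
    card_chain_through_one_four hn, card_image_range_Icc_one n, ?_⟩
  rw [card_chain_through_one_four hn, card_image_range_Icc_one n]
  omega
end

section
/- If x ∈ L_n is an arithmetic progression of cardinality k, then the interval [∅, x] in L_n (the set of all arithmetic progressions contained in x, ordered by inclusion) is order-isomorphic to L_k. -/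
open scoped Classical

/-- The affine embedding `j ↦ a + (j - 1) * r` of the integers, sending `1` to `a`. -/
def affineEmbedding (a r : ℤ) (hr : 1 ≤ r) : ℤ ↪ ℤ where
  toFun j := a + (j - 1) * r
  inj' i j h := by
    have h' : (i - 1) * r = (j - 1) * r := add_left_cancel h
    have := mul_right_cancel₀ (by omega : r ≠ 0) h'
    omega

lemma affineEmbedding_apply (a r : ℤ) (hr : 1 ≤ r) (j : ℤ) :
    affineEmbedding a r hr j = a + (j - 1) * r := rfl

lemma isAP_iff_mem (s : Finset ℤ) :
    IsAP s ↔ ∃ (a r : ℤ) (k : ℕ), 1 ≤ r ∧ ∀ v, v ∈ s ↔ ∃ i < k, a + ((i : ℕ) : ℤ) * r = v := by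
  simp [IsAP, Finset.ext_iff, Finset.bind_def, Finset.pure_def]

lemma IsAP.map_affineEmbedding {t : Finset ℤ} (ht : IsAP t) (a r : ℤ) (hr : 1 ≤ r) :
    IsAP (t.map (affineEmbedding a r hr)) := by
  rw [isAP_iff_mem] at ht ⊢
  obtain ⟨b, d, m, hd, hm⟩ := ht
  refine ⟨a + (b - 1) * r, d * r, m, by nlinarith, fun v => ?_⟩
  simp only [Finset.mem_map, affineEmbedding_apply, hm]
  constructor
  · rintro ⟨_, ⟨i, hi, rfl⟩, rfl⟩
    exact ⟨i, hi, by ring⟩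
  · rintro ⟨i, hi, rfl⟩
    exact ⟨_, ⟨i, hi, rfl⟩, by ring⟩

lemma isAP_of_isAP_map_affineEmbedding {t : Finset ℤ} {a r : ℤ} {hr : 1 ≤ r}
    (ht : IsAP (t.map (affineEmbedding a r hr))) : IsAP t := by
  rw [isAP_iff_mem] at ht ⊢
  obtain ⟨c, d, m, hd, hm⟩ := ht
  have mem_iff : ∀ v, v ∈ t ↔ ∃ i < m, c + ((i : ℕ) : ℤ) * d = a + (v - 1) * r := fun v => by
    rw [← Finset.mem_map' (affineEmbedding a r hr), hm, affineEmbedding_apply]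
  have exists_preimage : ∀ i < m, ∃ u, a + (u - 1) * r = c + ((i : ℕ) : ℤ) * d := fun i hi => by
    obtain ⟨u, -, hu⟩ := Finset.mem_map.1 ((hm _).2 ⟨i, hi, rfl⟩)
    exact ⟨u, hu⟩
  rcases Nat.eq_zero_or_pos m with rfl | hpos
  · exact ⟨0, 1, 0, le_rfl, fun v => by simp [mem_iff]⟩
  obtain ⟨u, hu⟩ := exists_preimage 0 hpos
  have hinj : ∀ {y z : ℤ}, a + (y - 1) * r = a + (z - 1) * r → y = z := fun h =>
    (affineEmbedding a r hr).injective h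
  obtain rfl | hlt : m = 1 ∨ 1 < m := by omega
  · refine ⟨u, 1, 1, le_rfl, fun v => ?_⟩
    simp only [mem_iff, Nat.lt_one_iff, exists_eq_left]
    constructor
    · intro h
      have := hinj (hu.trans h)
      simp [this]
    · intro h
      rw [← hu, ← h]
      simp
  · obtain ⟨w, hw⟩ := exists_preimage 1 hlt
    push_cast at hu hw
    have hd' : d = (w - u) * r := by linarith
    have hc : c = a + (u - 1) * r := by linarith
    refine ⟨u, w - u, m, by by_contra! h; nlinarith, fun v => ?_⟩
    rw [mem_iff]
    refine exists_congr fun i => and_congr_right fun _ => ⟨fun h => hinj ?_, fun h => ?_⟩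
    · rw [← h, hd', hc]; ring
    · rw [← h, hd', hc]; ring

lemma mem_map_affineEmbedding_Icc (a r : ℤ) (hr : 1 ≤ r) (k : ℕ) (v : ℤ) :
    v ∈ (Finset.Icc (1 : ℤ) k).map (affineEmbedding a r hr) ↔
      ∃ i < k, a + ((i : ℕ) : ℤ) * r = v := by
  simp only [Finset.mem_map, Finset.mem_Icc, affineEmbedding_apply]
  constructor
  · rintro ⟨j, ⟨h1, hk⟩, rfl⟩
    exact ⟨(j - 1).toNat, by omega, by rw [Int.toNat_of_nonneg (by omega)]⟩
  · rintro ⟨i, hi, rfl⟩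
    exact ⟨i + 1, by omega, by ring⟩

/-- If `x ∈ L_n` is an arithmetic progression of cardinality `k`, then the interval
`[∅, x]` in `L_n` (all arithmetic progressions contained in `x`, ordered by inclusion)
is order-isomorphic to `L_k`. -/
theorem interval_orderIso_Lk (n k : ℕ) (x : Finset ℤ) (hx : IsAP x)
    (hxn : x ⊆ Finset.Icc (1:ℤ) (n:ℤ)) (hcard : x.card = k) :
    Nonempty ({s : Finset ℤ // IsAP s ∧ s ⊆ x} ≃o
      {s : Finset ℤ // IsAP s ∧ s ⊆ Finset.Icc (1:ℤ) (k:ℤ)}) := by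
  obtain ⟨a, r, m, hr, hmem⟩ := (isAP_iff_mem x).1 hx
  have hmap : x = (Finset.Icc (1 : ℤ) m).map (affineEmbedding a r hr) := by
    ext v
    rw [hmem, mem_map_affineEmbedding_Icc]
  obtain rfl : m = k := by simpa [hmap] using hcard
  let f : {s : Finset ℤ // IsAP s ∧ s ⊆ Finset.Icc (1:ℤ) (m:ℤ)} ↪o
      {s : Finset ℤ // IsAP s ∧ s ⊆ x} :=
    OrderEmbedding.ofMapLEIff
      (fun t => ⟨t.1.map (affineEmbedding a r hr), t.2.1.map_affineEmbedding a r hr,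
        hmap ▸ Finset.map_subset_map.2 t.2.2⟩)
      (fun _ _ => Finset.map_subset_map)
  refine ⟨(RelIso.ofSurjective f ?_).symm⟩
  rintro ⟨s, hs, hsx⟩
  obtain ⟨t, ht, rfl⟩ := Finset.subset_map_iff.1 (hmap ▸ hsx)
  exact ⟨⟨t, isAP_of_isAP_map_affineEmbedding hs, ht⟩, rfl⟩
end

section
/- For n ≥ 4, the set A_n of coatoms of L_n (elements covered by the maximum [n]) is exactly B_n ∪ C_n, where B_n = { {1,2,...,n-1}, {2,3,...,n} } and C_n = { {1, 1+p, 1+2p, ..., n} : p prime, p divides n-1 }. -/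
open scoped Classical

/-- Here `i` ranges over `ℤ` on the left, since `Finset.range k` is coerced to `Finset ℤ`. -/
theorem mem_image_range_iff {a r v : ℤ} {k : ℕ} :
    v ∈ (Finset.range k).image (fun i => a + (i : ℤ) * r) ↔ ∃ i : ℕ, i < k ∧ a + i * r = v := by
  simp [Finset.bind_def]

theorem isAP_Icc (a b : ℤ) : IsAP (Finset.Icc a b) := by
  refine ⟨a, 1, (b + 1 - a).toNat, le_rfl, ?_⟩
  ext v
  rw [Finset.mem_Icc, mem_image_range_iff]
  constructor
  · rintro ⟨h1, h2⟩
    exact ⟨(v - a).toNat, by omega, by omega⟩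
  · rintro ⟨i, hi, rfl⟩
    omega

theorem mem_image_range_div_iff {n p : ℕ} (hn : 1 ≤ n) (hp : 0 < p) (hpn : p ∣ n - 1) (v : ℤ) :
    v ∈ (Finset.range ((n-1)/p + 1)).image (fun i => (1:ℤ) + (i:ℤ) * (p:ℤ)) ↔
      (1 ≤ v ∧ v ≤ n) ∧ (p : ℤ) ∣ v - 1 := by
  obtain ⟨q, hq⟩ := hpn
  have hn' : (n : ℤ) = p * q + 1 := by
    have : n = p * q + 1 := by omega
    exact_mod_cast this
  have hp' : (0 : ℤ) < p := by exact_mod_cast hp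
  rw [hq, Nat.mul_div_cancel_left _ hp]
  rw [mem_image_range_iff]
  constructor
  · rintro ⟨i, hi, rfl⟩
    have hi' : (i : ℤ) ≤ q := by omega
    exact ⟨⟨by nlinarith, by nlinarith⟩, i, by ring⟩
  · rintro ⟨⟨h1, h2⟩, c, hc⟩
    have hc0 : 0 ≤ c := by nlinarith
    have hcq : c ≤ q := le_of_mul_le_mul_left (by linarith) hp'
    lift c to ℕ using hc0
    exact ⟨c, by omega, by linarith⟩

/-- A progression in `{1,…,n}` through both endpoints is a residue class modulo a divisor
of `n - 1`. -/
theorem IsAP.exists_dvd_of_endpoints_mem {n : ℕ} {y : Finset ℤ} (hy : IsAP y)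
    (hsub : y ⊆ Finset.Icc (1:ℤ) (n:ℤ)) (h1 : (1:ℤ) ∈ y) (hn : (n:ℤ) ∈ y) :
    ∃ d : ℕ, 0 < d ∧ d ∣ n - 1 ∧ ∀ v : ℤ, v ∈ y ↔ (1 ≤ v ∧ v ≤ n) ∧ (d : ℤ) ∣ v - 1 := by
  obtain ⟨a, r, k, hr, rfl⟩ := hy
  lift r to ℕ using by omega
  have hsub' := fun i (hi : i < k) =>
    Finset.mem_Icc.1 (hsub (mem_image_range_iff.2 ⟨i, hi, rfl⟩))
  rw [mem_image_range_iff] at h1 hn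
  obtain ⟨i, hi, hi1⟩ := h1
  obtain ⟨j, hj, hjn⟩ := hn
  have ha1 : 1 ≤ a := by simpa using (hsub' 0 (by omega)).1
  obtain rfl : a = 1 := by nlinarith
  have hn1 : n = j * r + 1 := by
    zify
    linarith
  refine ⟨r, by omega, ⟨j, by rw [hn1, Nat.add_sub_cancel, mul_comm]⟩, fun v => ?_⟩
  constructor
  · intro hv
    refine ⟨Finset.mem_Icc.1 (hsub hv), ?_⟩
    obtain ⟨m, -, rfl⟩ := mem_image_range_iff.1 hv
    exact ⟨m, by ring⟩
  · rintro ⟨⟨hv1, hvn⟩, c, hc⟩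
    have hc0 : 0 ≤ c := by nlinarith
    have hcj : c ≤ j := le_of_mul_le_mul_left (a := (r : ℤ)) (by linarith) (by omega)
    lift c to ℕ using hc0
    exact mem_image_range_iff.2 ⟨c, by omega, by linarith⟩

/-- Removing a single element from `{1,…,n}` leaves a coatom as soon as what remains is a
progression. -/
theorem isCoatomIn_of_insert_eq {n : ℕ} {x : Finset ℤ} {m : ℤ} (hx : IsAP x) (hm : m ∉ x)
    (h : insert m x = Finset.Icc (1:ℤ) (n:ℤ)) : IsCoatomIn n x := by
  refine ⟨hx, h ▸ Finset.subset_insert m x, fun hxe => hm ?_, fun y _ hyn hxy => ?_⟩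
  · rw [hxe, ← h]
    exact Finset.mem_insert_self m x
  · obtain ⟨b, hby, hbx⟩ := Finset.exists_of_ssubset hxy
    have hbm : b = m := (Finset.mem_insert.1 (h ▸ hyn hby)).resolve_right hbx
    exact hyn.antisymm (h ▸ Finset.insert_subset (hbm ▸ hby) hxy.1)

/-- A coatom contained in a proper progression of `{1,…,n}` equals it. -/
theorem IsCoatomIn.eq_of_subset {n : ℕ} {x y : Finset ℤ} (hx : IsCoatomIn n x) (hy : IsAP y)
    (hyn : y ⊆ Finset.Icc (1:ℤ) (n:ℤ)) (hne : y ≠ Finset.Icc (1:ℤ) (n:ℤ)) (hxy : x ⊆ y) :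
    x = y := by
  by_contra h
  exact hne (hx.2.2.2 y hy hyn (hxy.ssubset_of_ne h))

theorem isAP_image_range_one_add {p : ℕ} (hp : 0 < p) (k : ℕ) :
    IsAP ((Finset.range k).image (fun i => (1:ℤ) + (i:ℤ) * (p:ℤ))) :=
  ⟨1, p, k, by exact_mod_cast hp, rfl⟩

theorem image_range_div_ne_Icc {n p : ℕ} (hn : 2 ≤ n) (hp : p.Prime) (hpn : p ∣ n - 1) :
    (Finset.range ((n-1)/p + 1)).image (fun i => (1:ℤ) + (i:ℤ) * (p:ℤ)) ≠
      Finset.Icc (1:ℤ) (n:ℤ) := by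
  intro h
  have h2 : (2:ℤ) ∈ Finset.Icc (1:ℤ) (n:ℤ) := Finset.mem_Icc.2 (by omega)
  rw [← h, mem_image_range_div_iff (by omega) hp.pos hpn] at h2
  have : (p : ℤ) ∣ (1 : ℕ) := by simpa using h2.2
  exact hp.one_lt.ne' (Nat.dvd_one.1 (Int.natCast_dvd_natCast.1 this))

theorem isCoatomIn_image_range_div {n p : ℕ} (hn : 2 ≤ n) (hp : p.Prime) (hpn : p ∣ n - 1) :
    IsCoatomIn n ((Finset.range ((n-1)/p + 1)).image (fun i => (1:ℤ) + (i:ℤ) * (p:ℤ))) := by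
  have hmem := mem_image_range_div_iff (by omega) hp.pos hpn
  refine ⟨isAP_image_range_one_add hp.pos _, fun v hv => Finset.mem_Icc.2 ((hmem v).1 hv).1,
    image_range_div_ne_Icc hn hp hpn, fun y hy hyn hxy => ?_⟩
  have hple : p ≤ n - 1 := Nat.le_of_dvd (by omega) hpn
  have h1 : (1:ℤ) ∈ y := hxy.1 ((hmem 1).2 ⟨by omega, by simp⟩)
  have hnn : (n:ℤ) ∈ y := by
    refine hxy.1 ((hmem n).2 ⟨by omega, ?_⟩)
    have := Int.natCast_dvd_natCast.2 hpn
    rwa [Nat.cast_sub (by omega), Nat.cast_one] at this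
  have hp1 : (1 + p : ℤ) ∈ y := hxy.1 ((hmem _).2 ⟨by omega, by simp⟩)
  obtain ⟨d, -, -, hd⟩ := hy.exists_dvd_of_endpoints_mem hyn h1 hnn
  have hdp : d ∣ p := by
    have := ((hd _).1 hp1).2
    rw [add_sub_cancel_left] at this
    exact Int.natCast_dvd_natCast.1 this
  rcases (Nat.dvd_prime hp).1 hdp with rfl | rfl
  · ext v
    simp [hd]
  · exact absurd (Finset.ext fun v => (hmem v).trans (hd v).symm) hxy.ne

theorem IsCoatomIn.exists_prime_of_endpoints_mem {n : ℕ} {x : Finset ℤ} (hn : 2 ≤ n)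
    (hx : IsCoatomIn n x) (h1 : (1:ℤ) ∈ x) (hnx : (n:ℤ) ∈ x) :
    ∃ p : ℕ, p.Prime ∧ p ∣ (n - 1) ∧
      x = (Finset.range ((n-1)/p + 1)).image (fun i => (1:ℤ) + (i:ℤ) * (p:ℤ)) := by
  obtain ⟨d, -, hdn, hd⟩ := hx.1.exists_dvd_of_endpoints_mem hx.2.1 h1 hnx
  have hd1 : d ≠ 1 := by
    rintro rfl
    exact hx.2.2.1 (by ext v; simp [hd])
  obtain ⟨p, hp, hpd⟩ := Nat.exists_prime_and_dvd hd1
  have hpn := hpd.trans hdn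
  have hmem := mem_image_range_div_iff (by omega) hp.pos hpn
  refine ⟨p, hp, hpn, hx.eq_of_subset (isAP_image_range_one_add hp.pos _)
    (fun v hv => Finset.mem_Icc.2 ((hmem v).1 hv).1) (image_range_div_ne_Icc hn hp hpn)
    fun v hv => (hmem v).2 ?_⟩
  obtain ⟨hv1, hv2⟩ := (hd v).1 hv
  exact ⟨hv1, (Int.natCast_dvd_natCast.2 hpd).trans hv2⟩

/-- For `n ≥ 4`, the coatoms of `L_n` are exactly `{1,…,n-1}`, `{2,…,n}`, and the
progressions `{1, 1+p, 1+2p, …, n}` for primes `p` dividing `n-1`. -/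
theorem coatoms_Ln (n : ℕ) (hn : 4 ≤ n) (x : Finset ℤ) :
    IsCoatomIn n x ↔
      x = Finset.Icc (1:ℤ) ((n:ℤ) - 1) ∨ x = Finset.Icc (2:ℤ) (n:ℤ) ∨
      ∃ p : ℕ, p.Prime ∧ p ∣ (n - 1) ∧
        x = (Finset.range ((n-1)/p + 1)).image (fun i => (1:ℤ) + (i:ℤ) * (p:ℤ)) := by
  constructor
  · intro hx
    have hbounds := fun v (hv : v ∈ x) => Finset.mem_Icc.1 (hx.2.1 hv)
    by_cases hnx : (n:ℤ) ∈ x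
    · by_cases h1 : (1:ℤ) ∈ x
      · exact Or.inr (Or.inr (hx.exists_prime_of_endpoints_mem (by omega) h1 hnx))
      · refine Or.inr (Or.inl (hx.eq_of_subset (isAP_Icc _ _)
          (Finset.Icc_subset_Icc_left (by norm_num)) (fun h => ?_) fun v hv => ?_))
        · have : (1:ℤ) ∈ Finset.Icc (2:ℤ) (n:ℤ) := h ▸ Finset.mem_Icc.2 (by omega)
          simp at this
        · have hne : v ≠ 1 := ne_of_mem_of_not_mem hv h1
          have := hbounds v hv
          exact Finset.mem_Icc.2 (by omega)
    · refine Or.inl (hx.eq_of_subset (isAP_Icc _ _)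
        (Finset.Icc_subset_Icc_right (by omega)) (fun h => ?_) fun v hv => ?_)
      · have : (n:ℤ) ∈ Finset.Icc (1:ℤ) ((n:ℤ) - 1) := h ▸ Finset.mem_Icc.2 (by omega)
        simp at this
      · have hne : v ≠ n := ne_of_mem_of_not_mem hv hnx
        have := hbounds v hv
        exact Finset.mem_Icc.2 (by omega)
  · rintro (rfl | rfl | ⟨p, hp, hpn, rfl⟩)
    · refine isCoatomIn_of_insert_eq (m := n) (isAP_Icc _ _) (by simp) ?_
      ext v
      simp only [Finset.mem_insert, Finset.mem_Icc]
      omega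
    · refine isCoatomIn_of_insert_eq (m := 1) (isAP_Icc _ _) (by simp) ?_
      ext v
      simp only [Finset.mem_insert, Finset.mem_Icc]
      omega
    · exact isCoatomIn_image_range_div (by omega) hp hpn
end

section
/- Let x₁ ≤ x₂ be elements of L_n and let C be the set of elements of L_n covered by x₂. If x₁ = ⋀_{s∈S} s for some subset S ⊆ C, then μ_{L_n}(x₁, x₂) = (-1)^{|S|} (and any two such subsets S have the same cardinality); if x₁ is not a meet of elements of C, then μ_{L_n}(x₁, x₂) = 0. In particular, μ_{L_n}(x₁, x₂) ∈ {-1, 0, 1} for every interval of L_n. -/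
open scoped Classical

theorem isAP_iff_exists_mem_iff {s : Finset ℤ} : IsAP s ↔
    ∃ (a r : ℤ) (k : ℕ), 1 ≤ r ∧ ∀ v, v ∈ s ↔ ∃ i : ℕ, i < k ∧ a + (i : ℤ) * r = v := by
  unfold IsAP
  simp only [Finset.ext_iff, Finset.bind_def, Finset.pure_def, Finset.mem_image, Finset.mem_sup,
    Finset.mem_range, Finset.mem_singleton]
  have h (a r v : ℤ) (k : ℕ) : (∃ j : ℤ, (∃ i < k, j = (i : ℤ)) ∧ a + j * r = v) ↔
      ∃ i : ℕ, i < k ∧ a + (i : ℤ) * r = v :=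
    ⟨fun ⟨_, ⟨i, hi, hj⟩, hv⟩ => ⟨i, hi, hj ▸ hv⟩, fun ⟨i, hi, hv⟩ => ⟨i, ⟨i, hi, rfl⟩, hv⟩⟩
  simp only [h]

theorem isAP_of_mem_iff {s : Finset ℤ} {l u r a : ℤ} (hr : 1 ≤ r)
    (h : ∀ v, v ∈ s ↔ l ≤ v ∧ v ≤ u ∧ r ∣ v - a) : IsAP s := by
  rcases s.eq_empty_or_nonempty with rfl | hne
  · exact isAP_empty
  have hm := s.min'_mem hne
  have hmin : ∀ v ∈ s, s.min' hne ≤ v := fun v hv => s.min'_le v hv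
  generalize s.min' hne = m at hm hmin
  obtain ⟨h1, h2, h3⟩ := (h m).1 hm
  refine isAP_iff_exists_mem_iff.2 ⟨m, r, ((u - m) / r).toNat + 1, hr, fun v => ?_⟩
  have hq : 0 ≤ (u - m) / r := Int.ediv_nonneg (by omega) (by omega)
  constructor
  · intro hv
    obtain ⟨_, h5, h6⟩ := (h v).1 hv
    obtain ⟨t, ht⟩ : r ∣ v - m := by simpa using dvd_sub h6 h3
    have hmv := hmin v hv
    have ht0 : 0 ≤ t := by
      by_contra! hneg
      nlinarith
    have htq : t ≤ (u - m) / r := by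
      rw [Int.le_ediv_iff_mul_le (by omega)]
      nlinarith
    refine ⟨t.toNat, by omega, ?_⟩
    rw [Int.toNat_of_nonneg ht0]
    linarith
  · rintro ⟨i, hi, rfl⟩
    have hi' : (i : ℤ) ≤ (u - m) / r := by omega
    rw [Int.le_ediv_iff_mul_le (by omega)] at hi'
    refine (h _).2 ⟨by nlinarith [Int.natCast_nonneg i], by linarith, ?_⟩
    rw [show m + (i : ℤ) * r - a = m - a + i * r by ring]
    exact dvd_add h3 (dvd_mul_left _ _)

theorem IsAP.eq_empty_or_mem_iff {s : Finset ℤ} (hs : IsAP s) :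
    s = ∅ ∨ ∃ a b r : ℤ, 1 ≤ r ∧ a ≤ b ∧ r ∣ b - a ∧
      ∀ v, v ∈ s ↔ a ≤ v ∧ v ≤ b ∧ r ∣ v - a := by
  obtain ⟨a, r, k, hr, h⟩ := isAP_iff_exists_mem_iff.1 hs
  cases k with
  | zero => exact Or.inl (Finset.eq_empty_of_forall_notMem fun v hv => by simp [h] at hv)
  | succ k =>
    refine Or.inr ⟨a, a + k * r, r, hr, by nlinarith [Int.natCast_nonneg k], by simp, fun v => ?_⟩
    rw [h]
    constructor
    · rintro ⟨i, hi, rfl⟩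
      have : (i : ℤ) ≤ k := by omega
      exact ⟨by nlinarith [Int.natCast_nonneg i], by nlinarith, by simp⟩
    · rintro ⟨h1, h2, t, ht⟩
      have ht0 : 0 ≤ t := by
        by_contra! hneg
        nlinarith
      have htk : t ≤ k := by
        by_contra! hlt
        nlinarith
      refine ⟨t.toNat, by omega, ?_⟩
      rw [Int.toNat_of_nonneg ht0]
      linarith

theorem isAP_inter {s t : Finset ℤ} (hs : IsAP s) (ht : IsAP t) : IsAP (s ⊓ t) := by
  rcases hs.eq_empty_or_mem_iff with rfl | ⟨a, b, r, hr, -, -, hs'⟩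
  · simpa using hs
  rcases ht.eq_empty_or_mem_iff with rfl | ⟨a', b', r', hr', -, -, ht'⟩
  · simpa using ht
  rcases (s ⊓ t).eq_empty_or_nonempty with h | ⟨m, hm⟩
  · exact h ▸ isAP_empty
  rw [Finset.inf_eq_inter, Finset.mem_inter, hs', ht'] at hm
  obtain ⟨⟨-, -, hd⟩, -, -, hd'⟩ := hm
  have key : ∀ {r a : ℤ}, r ∣ m - a → ∀ v, r ∣ v - a ↔ r ∣ v - m := fun h v => by
    rw [← dvd_sub_left h, sub_sub_sub_cancel_right]
  refine isAP_of_mem_iff (l := max a a') (u := min b b') (r := (Int.lcm r r' : ℤ)) (a := m) ?_ ?_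
  · have : 0 < Int.lcm r r' := Int.lcm_pos (by omega) (by omega)
    omega
  · intro v
    rw [Finset.inf_eq_inter, Finset.mem_inter, hs', ht', key hd, key hd', Int.coe_lcm_dvd_iff,
      max_le_iff, le_min_iff]
    tauto

theorem mem_apMeet {t : Finset ℤ} {S : Finset (Finset ℤ)} {v : ℤ} :
    v ∈ apMeet t S ↔ v ∈ t ∧ ∀ s ∈ S, v ∈ s := by
  unfold apMeet
  induction S using Finset.induction_on with
  | empty => simp
  | insert s S hs ih =>
    rw [Finset.fold_insert hs, Finset.inf_eq_inter, Finset.mem_inter, ih, Finset.forall_mem_insert]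
    simp only [id]
    tauto

theorem isAP_apMeet {t : Finset ℤ} {S : Finset (Finset ℤ)} (ht : IsAP t)
    (hS : ∀ s ∈ S, IsAP s) : IsAP (apMeet t S) := by
  unfold apMeet
  induction S using Finset.induction_on with
  | empty => simpa using ht
  | insert s S hs ih =>
    rw [Finset.forall_mem_insert] at hS
    rw [Finset.fold_insert hs]
    exact isAP_inter hS.1 (ih hS.2)

theorem CoveredIn.eq_of_subset {y c z : Finset ℤ} (hc : CoveredIn y c) (hz : IsAP z)
    (hcz : c ⊆ z) (hzy : z ⊂ y) : c = z := by
  by_contra hne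
  exact hc.2.2 ⟨z, hz, hcz.ssubset_of_ne hne, hzy⟩

theorem CoveredIn.eq_erase {y c : Finset ℤ} {b : ℤ} (hc : CoveredIn y c) (hb : b ∈ y)
    (hAP : IsAP (y.erase b)) (hbc : b ∉ c) : c = y.erase b :=
  hc.eq_of_subset hAP (Finset.subset_erase.2 ⟨hc.2.1.subset, hbc⟩) (Finset.erase_ssubset hb)

theorem exists_coveredIn_of_ssubset {y z : Finset ℤ} (hz : IsAP z) (hzy : z ⊂ y) :
    ∃ c, CoveredIn y c ∧ z ⊆ c := by
  obtain ⟨c, hc, hmax⟩ := (y.powerset.filter (fun w => IsAP w ∧ z ⊆ w ∧ w ≠ y)).exists_maximal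
    ⟨z, by simp [hz, hzy.subset, hzy.ne]⟩
  simp only [Finset.mem_filter, Finset.mem_powerset, and_imp] at hc hmax
  refine ⟨c, ⟨hc.2.1, hc.1.ssubset_of_ne hc.2.2.2, ?_⟩, hc.2.2.1⟩
  rintro ⟨w, hw, hcw, hwy⟩
  exact hcw.not_subset (hmax hwy.subset hw (hc.2.2.1.trans hcw.subset) hwy.ne hcw.subset)

/-- A progression covered by `y` and containing both endpoints of `y` consists of every `p`-th
element of `y`, for some prime `p`. -/
theorem CoveredIn.exists_prime {y c : Finset ℤ} {a b r : ℤ} (hr : 1 ≤ r) (hab : a ≤ b)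
    (hy : ∀ v, v ∈ y ↔ a ≤ v ∧ v ≤ b ∧ r ∣ v - a) (hc : CoveredIn y c) (hac : a ∈ c)
    (hbc : b ∈ c) :
    ∃ p : ℕ, p.Prime ∧ a < b ∧ r * p ∣ b - a ∧
      ∀ v, v ∈ c ↔ a ≤ v ∧ v ≤ b ∧ r * p ∣ v - a := by
  rcases hc.1.eq_empty_or_mem_iff with rfl | ⟨a', b', d, hd, hab', hdb, hc'⟩
  · simp at hac
  obtain rfl : a' = a := le_antisymm ((hc' a).1 hac).1
    ((hy a').1 (hc.2.1.subset ((hc' a').2 ⟨le_rfl, hab', by simp⟩))).1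
  obtain rfl : b' = b := le_antisymm
    ((hy b').1 (hc.2.1.subset ((hc' b').2 ⟨hab', le_rfl, hdb⟩))).2.1 ((hc' b).1 hbc).2.1
  have hlt : a' < b' := by
    refine lt_of_le_of_ne hab fun h => hc.2.1.not_subset fun v hv => ?_
    have := (hy v).1 hv
    rwa [show v = a' by omega]
  have hdle : d ≤ b' - a' := Int.le_of_dvd (by omega) hdb
  obtain ⟨m, rfl⟩ : r ∣ d := by
    have : a' + d ∈ c := (hc' _).2 ⟨by omega, by omega, by simp⟩
    simpa using ((hy _).1 (hc.2.1.subset this)).2.2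
  have hm : m.natAbs ≠ 1 := by
    intro h
    have hm1 : m = 1 := by
      rcases Int.natAbs_eq m with h' | h' <;> rw [h] at h'
      · exact h'
      · rw [h'] at hd
        push_cast at hd
        linarith
    subst hm1
    refine hc.2.1.not_subset fun v hv => (hc' v).2 ?_
    simpa using (hy v).1 hv
  obtain ⟨p, hp, hpm⟩ := Nat.exists_prime_and_dvd hm
  have hpm' : r * p ∣ r * m := mul_dvd_mul_left r (Int.natCast_dvd.2 hpm)
  have hp2 : (2 : ℤ) ≤ p := by exact_mod_cast hp.two_le
  have hP : ∀ v, v ∈ y.filter (fun v => r * p ∣ v - a') ↔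
      a' ≤ v ∧ v ≤ b' ∧ r * p ∣ v - a' := by
    intro v
    rw [Finset.mem_filter, hy]
    exact ⟨fun h => ⟨h.1.1, h.1.2.1, h.2⟩,
      fun h => ⟨⟨h.1, h.2.1, (dvd_mul_right r p).trans h.2.2⟩, h.2.2⟩⟩
  refine ⟨p, hp, hlt, hpm'.trans hdb, fun v => ?_⟩
  rw [← hP, ← hc.eq_of_subset (isAP_of_mem_iff (by nlinarith) hP)]
  · intro w hw
    have := (hc' w).1 hw
    exact (hP w).2 ⟨this.1, this.2.1, hpm'.trans this.2.2⟩
  · refine (Finset.filter_subset _ _).ssubset_of_ne fun h => ?_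
    have hrle : r ≤ r * m := Int.le_of_dvd (by omega) (dvd_mul_right _ _)
    have hmem : a' + r ∈ y := (hy _).2 ⟨by omega, by omega, by simp⟩
    rw [← h, hP, add_sub_cancel_left] at hmem
    have := Int.le_of_dvd (by omega) hmem.2.2
    nlinarith

/-- Every element covered by `y` misses some element of `y` contained in all the others. -/
theorem CoveredIn.exists_mem_of_ne {y c : Finset ℤ} (hy : IsAP y) (hc : CoveredIn y c) :
    ∃ v ∈ y, v ∉ c ∧ ∀ c', CoveredIn y c' → c' ≠ c → v ∈ c' := by
  rcases hy.eq_empty_or_mem_iff with rfl | ⟨a, b, r, hr, hab, hrb, hy'⟩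
  · exact absurd hc.2.1 (Finset.not_ssubset_empty _)
  have ha : a ∈ y := (hy' a).2 ⟨le_rfl, hab, by simp⟩
  have hb : b ∈ y := (hy' b).2 ⟨hab, le_rfl, hrb⟩
  have hAPa : IsAP (y.erase a) := by
    refine isAP_of_mem_iff (l := a + 1) (u := b) (a := a) hr fun v => ?_
    rw [Finset.mem_erase, hy']
    grind
  have hAPb : IsAP (y.erase b) := by
    refine isAP_of_mem_iff (l := a) (u := b - 1) (a := a) hr fun v => ?_
    rw [Finset.mem_erase, hy']
    grind
  have endpoint : ∀ e, e ∈ y → IsAP (y.erase e) → e ∉ c →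
      ∃ v ∈ y, v ∉ c ∧ ∀ c', CoveredIn y c' → c' ≠ c → v ∈ c' := by
    refine fun e he hAP hec => ⟨e, he, hec, fun c' hc' hne => ?_⟩
    by_contra hec'
    exact hne ((hc'.eq_erase he hAP hec').trans (hc.eq_erase he hAP hec).symm)
  by_cases hac : a ∈ c
  swap
  · exact endpoint a ha hAPa hac
  by_cases hbc : b ∈ c
  swap
  · exact endpoint b hb hAPb hbc
  obtain ⟨p, hp, hlt, hpb, hcp⟩ := hc.exists_prime hr hab hy' hac hbc
  obtain ⟨N, hN⟩ := hrb
  have hNpos : 0 < N := by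
    by_contra! h
    nlinarith
  lift N to ℕ using hNpos.le
  have hNpos' : 0 < N := by exact_mod_cast hNpos
  have hr0 : r ≠ 0 := by omega
  have dvd_iff : ∀ q e : ℕ, r * q ∣ r * e ↔ q ∣ e := fun q e => by
    rw [mul_dvd_mul_iff_left hr0, Int.natCast_dvd_natCast]
  rw [hN, dvd_iff] at hpb
  obtain ⟨j, e, hpe, hNe⟩ := Nat.exists_eq_pow_mul_and_not_dvd hNpos'.ne' p hp.ne_one
  have he0 : 0 < e := Nat.pos_of_ne_zero fun h => hpe (h ▸ dvd_zero p)
  have heN : e < N := lt_of_le_of_ne (Nat.le_of_dvd hNpos' (hNe ▸ dvd_mul_left _ _))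
    fun h => hpe (h ▸ hpb)
  have h1 : a < a + r * e := by nlinarith [(by exact_mod_cast he0 : (0 : ℤ) < e)]
  have h2 : a + r * e < b := by nlinarith [(by exact_mod_cast heN : (e : ℤ) < N)]
  have hv : a + r * e ∈ y := (hy' _).2 ⟨h1.le, h2.le, by simp⟩
  refine ⟨a + r * e, hv, fun h => ?_, fun c' hc' hne => ?_⟩
  · have := ((hcp _).1 h).2.2
    rw [add_sub_cancel_left, dvd_iff] at this
    exact hpe this
  by_cases hac' : a ∈ c'
  swap
  · rw [hc'.eq_erase ha hAPa hac', Finset.mem_erase]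
    exact ⟨h1.ne', hv⟩
  by_cases hbc' : b ∈ c'
  swap
  · rw [hc'.eq_erase hb hAPb hbc', Finset.mem_erase]
    exact ⟨h2.ne, hv⟩
  obtain ⟨q, hq, -, hqb, hcq⟩ := hc'.exists_prime hr hab hy' hac' hbc'
  rw [hN, dvd_iff, hNe] at hqb
  have hqp : q ≠ p := by
    rintro rfl
    exact hne (Finset.ext fun v => (hcq v).trans (hcp v).symm)
  refine (hcq _).2 ⟨h1.le, h2.le, ?_⟩
  rw [add_sub_cancel_left, dvd_iff]
  exact (((Nat.coprime_primes hq hp).2 hqp).pow_right j).dvd_of_dvd_mul_left hqb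

theorem apMeet_injOn {y : Finset ℤ} (hy : IsAP y) {S S' : Finset (Finset ℤ)}
    (hS : ∀ s ∈ S, CoveredIn y s) (hS' : ∀ s ∈ S', CoveredIn y s)
    (h : apMeet y S = apMeet y S') : S = S' := by
  have key : ∀ {S S' : Finset (Finset ℤ)}, (∀ s ∈ S, CoveredIn y s) →
      (∀ s ∈ S', CoveredIn y s) → apMeet y S = apMeet y S' → S ⊆ S' := by
    intro S S' hS hS' h s hs
    by_contra hs'
    obtain ⟨v, hvy, hvs, hv⟩ := (hS s hs).exists_mem_of_ne hy
    have hmem : v ∈ apMeet y S' :=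
      mem_apMeet.2 ⟨hvy, fun c hc => hv c (hS' c hc) (ne_of_mem_of_not_mem hc hs')⟩
    rw [← h, mem_apMeet] at hmem
    exact hvs (hmem.2 s hs)
  exact (key hS hS' h).antisymm (key hS' hS h.symm)

theorem sum_apMu {x w y : Finset ℤ} (hw : IsAP w) (hwy : w ⊆ y) :
    ∑ z ∈ y.powerset.filter (fun z => IsAP z ∧ x ⊆ z ∧ z ⊆ w), apMu x z =
      if w = x then 1 else 0 := by
  have hfilter : y.powerset.filter (fun z => IsAP z ∧ x ⊆ z ∧ z ⊆ w) =
      w.powerset.filter (fun z => IsAP z ∧ x ⊆ z) := by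
    ext z
    simp only [Finset.mem_filter, Finset.mem_powerset]
    exact ⟨fun h => ⟨h.2.2.2, h.2.1, h.2.2.1⟩, fun h => ⟨h.1.trans hwy, h.2.1, h.2.2, h.1⟩⟩
  rw [hfilter]
  by_cases hxw : x ⊆ w
  · have hins : w.powerset.filter (fun z => IsAP z ∧ x ⊆ z) =
        insert w (w.powerset.filter (fun z => IsAP z ∧ x ⊆ z ∧ z ≠ w)) := by
      ext z
      simp only [Finset.mem_filter, Finset.mem_powerset, Finset.mem_insert]
      by_cases hzw : z = w
      · subst hzw
        simp [hw, hxw]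
      · simp [hzw]
    rw [hins, Finset.sum_insert (by simp), apMu]
    split_ifs with h1 h2 h2
    · subst h1
      rw [Finset.sum_eq_zero, add_zero]
      intro z hz
      simp only [Finset.mem_filter, Finset.mem_powerset] at hz
      exact absurd (hz.1.antisymm hz.2.2.1) hz.2.2.2
    · exact absurd h1.symm h2
    · exact absurd h2.symm h1
    · rw [Finset.sum_attach _ (fun z => apMu x z), neg_add_cancel]
  · rw [if_neg fun h => hxw h.symm.subset]
    refine Finset.sum_eq_zero fun z hz => ?_
    simp only [Finset.mem_filter, Finset.mem_powerset] at hz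
    exact absurd (hz.2.2.trans hz.1) hxw

/-- The crosscut formula for the Möbius function. -/
theorem apMu_eq_sum_crosscut {x y : Finset ℤ} (hy : IsAP y) (hxy : x ⊆ y) :
    apMu x y = ∑ S ∈ (y.powerset.filter (CoveredIn y)).powerset,
      if apMeet y S = x then (-1) ^ S.card else 0 := by
  set C := y.powerset.filter (CoveredIn y) with hC
  have hmemC : ∀ {c}, c ∈ C ↔ CoveredIn y c := fun {c} => by
    rw [hC, Finset.mem_filter, Finset.mem_powerset]
    exact ⟨fun h => h.2, fun h => ⟨h.2.1.subset, h⟩⟩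
  set I := y.powerset.filter (fun z => IsAP z ∧ x ⊆ z) with hI
  have hdelta : ∀ z ∈ I, ∑ S ∈ C.powerset,
      (if z ⊆ apMeet y S then (-1 : ℤ) ^ S.card else 0) = if z = y then 1 else 0 := by
    intro z hz
    simp only [hI, Finset.mem_filter, Finset.mem_powerset] at hz
    have hpow : C.powerset.filter (fun S => z ⊆ apMeet y S) =
        (C.filter (fun c => z ⊆ c)).powerset := by
      ext S
      simp only [Finset.mem_filter, Finset.mem_powerset, Finset.subset_iff (s₁ := S)]
      refine ⟨fun h c hc => ⟨h.1 hc, fun v hv => (mem_apMeet.1 (h.2 hv)).2 c hc⟩,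
        fun h => ⟨fun c hc => (h hc).1, fun v hv =>
          mem_apMeet.2 ⟨hz.1 hv, fun c hc => (h hc).2 hv⟩⟩⟩
    rw [← Finset.sum_filter, hpow, Finset.sum_powerset_neg_one_pow_card]
    refine if_congr ?_ rfl rfl
    rw [Finset.filter_eq_empty_iff]
    constructor
    · intro h
      by_contra hne
      obtain ⟨c, hc, hzc⟩ := exists_coveredIn_of_ssubset hz.2.1 (hz.1.ssubset_of_ne hne)
      exact h (hmemC.2 hc) hzc
    · rintro rfl c hc hzc
      exact (hmemC.1 hc).2.1.not_subset hzc
  calc apMu x y = ∑ z ∈ I, apMu x z * (if z = y then 1 else 0) := by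
        simp [hI, hy, hxy]
    _ = ∑ z ∈ I, ∑ S ∈ C.powerset,
          (if z ⊆ apMeet y S then (-1) ^ S.card * apMu x z else 0) := by
        refine Finset.sum_congr rfl fun z hz => ?_
        rw [← hdelta z hz, Finset.mul_sum]
        refine Finset.sum_congr rfl fun S _ => ?_
        split_ifs <;> ring
    _ = ∑ S ∈ C.powerset, ∑ z ∈ I,
          (if z ⊆ apMeet y S then (-1) ^ S.card * apMu x z else 0) := Finset.sum_comm
    _ = _ := by
        refine Finset.sum_congr rfl fun S hS => ?_
        have hSC : ∀ s ∈ S, IsAP s := fun s hs => (hmemC.1 (Finset.mem_powerset.1 hS hs)).1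
        rw [← Finset.sum_filter, ← Finset.mul_sum, hI, Finset.filter_filter]
        simp only [and_assoc]
        rw [sum_apMu (isAP_apMeet hy hSC) fun v hv => (mem_apMeet.1 hv).1]
        split_ifs <;> ring

/-- For `x₁ ≤ x₂` in `L_n`, letting `C` be the set of elements of `L_n` covered by
`x₂`: if `x₁` is the meet of a subset `S ⊆ C` then `μ_{L_n}(x₁,x₂) = (-1)^{|S|}`
(and any two such subsets have the same cardinality); if `x₁` is not a meet of
elements of `C` then `μ_{L_n}(x₁,x₂) = 0`.  In particular
`μ_{L_n}(x₁,x₂) ∈ {-1,0,1}`. -/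
theorem mobius_interval_via_covers (n : ℕ) (x₁ x₂ : Finset ℤ)
    (h₁ : IsAP x₁) (h₂ : IsAP x₂) (hn : x₂ ⊆ Finset.Icc (1:ℤ) (n:ℤ)) (h₁₂ : x₁ ⊆ x₂) :
    (∀ S : Finset (Finset ℤ), (∀ s ∈ S, CoveredIn x₂ s) →
        apMeet x₂ S = x₁ → apMu x₁ x₂ = (-1)^S.card) ∧
    (∀ S S' : Finset (Finset ℤ), (∀ s ∈ S, CoveredIn x₂ s) →
        (∀ s ∈ S', CoveredIn x₂ s) → apMeet x₂ S = x₁ → apMeet x₂ S' = x₁ →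
        S.card = S'.card) ∧
    ((¬ ∃ S : Finset (Finset ℤ), (∀ s ∈ S, CoveredIn x₂ s) ∧ apMeet x₂ S = x₁) →
        apMu x₁ x₂ = 0) ∧
    (apMu x₁ x₂ = -1 ∨ apMu x₁ x₂ = 0 ∨ apMu x₁ x₂ = 1) := by
  have hC : ∀ {S : Finset (Finset ℤ)}, S ∈ (x₂.powerset.filter (CoveredIn x₂)).powerset ↔
      ∀ s ∈ S, CoveredIn x₂ s := fun {S} => by
    simp only [Finset.mem_powerset, Finset.subset_iff (s₁ := S), Finset.mem_filter]
    exact ⟨fun h s hs => (h hs).2, fun h s hs => ⟨(h s hs).2.1.subset, h s hs⟩⟩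
  have hpos : ∀ S : Finset (Finset ℤ), (∀ s ∈ S, CoveredIn x₂ s) →
      apMeet x₂ S = x₁ → apMu x₁ x₂ = (-1) ^ S.card := by
    intro S hS hSx
    rw [apMu_eq_sum_crosscut h₂ h₁₂, Finset.sum_eq_single_of_mem S (hC.2 hS), if_pos hSx]
    intro S' hS' hne
    exact if_neg fun h => hne (apMeet_injOn h₂ (hC.1 hS') hS (h.trans hSx.symm))
  have hzero : (¬ ∃ S : Finset (Finset ℤ), (∀ s ∈ S, CoveredIn x₂ s) ∧ apMeet x₂ S = x₁) →
      apMu x₁ x₂ = 0 := by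
    intro h
    rw [apMu_eq_sum_crosscut h₂ h₁₂]
    exact Finset.sum_eq_zero fun S hS => if_neg fun hSx => h ⟨S, hC.1 hS, hSx⟩
  refine ⟨hpos, fun S S' hS hS' h h' => ?_, hzero, ?_⟩
  · rw [apMeet_injOn h₂ hS hS' (h.trans h'.symm)]
  · by_cases h : ∃ S : Finset (Finset ℤ), (∀ s ∈ S, CoveredIn x₂ s) ∧ apMeet x₂ S = x₁
    · obtain ⟨S, hS, hSx⟩ := h
      rw [hpos S hS hSx]
      rcases neg_one_pow_eq_or ℤ S.card with h | h <;> simp [h]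
    · exact Or.inr (Or.inl (hzero h))
end
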